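/- Under the online chaining-tree protocol with the parameter-free grad-step assumption, for every f in the Hölder class 𝒞^α(𝒳,L) (with L > 0, α ∈ (0,1]), the piecewise-constant approximation f̂*(x) = Σ_{j∈J_H} f(x_{H,j})·1{x ∈ 𝒳_{H,j}} satisfies Σ_{t=1}^T ℓ_t(f̂_t(x_t)) − Σ_{t=1}^T ℓ_t(f̂*(x_t)) ≤ B·G·(C₁·√T + C₂) + L·G·D^α·( 2^{−d/2}·C₁·√T·Σ_{m=2}^{H} 2^{m(d/2−α)} + 2^{−d}·C₂·Σ_{m=2}^{H} 2^{m(d−α)} ). -/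

import Mathlib

open Finset

noncomputable section

/-- The dyadic index set at level `m`. -/
def Jset (d m : ℕ) : Finset (Fin d → ℕ) :=
  Fintype.piFinset fun _ => Finset.range (2 ^ (m - 1))

/-- Real-valued indicator of a set. -/
def indR {α : Type*} (s : Set α) (x : α) : ℝ := Set.indicator s (fun _ => (1 : ℝ)) x

/-- A dyadic chaining-tree structure of depth `H` on `X ⊆ ℝ^d` with diameter bound `D`. -/
structure DyadicTree (d : ℕ) (X : Set (Fin d → ℝ)) (D : ℝ) (H : ℕ) where
  cell : ℕ → (Fin d → ℕ) → Set (Fin d → ℝ)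
  pt : ℕ → (Fin d → ℕ) → (Fin d → ℝ)
  root_eq : cell 1 0 = X
  child_sub : ∀ m : ℕ, 1 ≤ m → m < H → ∀ j' ∈ Jset d (m + 1),
    cell (m + 1) j' ⊆ cell m (fun i => j' i / 2)
  partition : ∀ m : ℕ, 1 ≤ m → m < H → ∀ j ∈ Jset d m, ∀ x ∈ cell m j,
    ∃! j' : Fin d → ℕ,
      j' ∈ Jset d (m + 1) ∧ (∀ i, j' i / 2 = j i) ∧ x ∈ cell (m + 1) j'
  pt_dist : ∀ m ∈ Finset.Icc 1 H, ∀ j ∈ Jset d m, ∀ x ∈ cell m j,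
    ‖x - pt m j‖ ≤ (2 : ℝ) ^ (-(m : ℝ)) * D
  parent_dist : ∀ m : ℕ, 1 ≤ m → m < H → ∀ j' ∈ Jset d (m + 1),
    ‖pt (m + 1) j' - pt m (fun i => j' i / 2)‖ ≤ (2 : ℝ) ^ (-((m : ℝ) + 1)) * D

theorem indR_nonneg {α : Type*} (s : Set α) (x : α) : 0 ≤ indR s x :=
  Set.indicator_nonneg (fun _ _ => zero_le_one) x

theorem indR_of_mem {α : Type*} {s : Set α} {x : α} (h : x ∈ s) : indR s x = 1 :=
  Set.indicator_of_mem h _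

theorem indR_of_notMem {α : Type*} {s : Set α} {x : α} (h : x ∉ s) : indR s x = 0 :=
  Set.indicator_of_notMem h _

theorem indR_sq {α : Type*} (s : Set α) (x : α) : indR s x ^ 2 = indR s x := by
  by_cases h : x ∈ s
  · simp [indR_of_mem h]
  · simp [indR_of_notMem h]

theorem card_Jset (d m : ℕ) : (Jset d m).card = (2 ^ (m - 1)) ^ d := by
  simp [Jset]

theorem half_mem_Jset {d m : ℕ} (hm : 1 ≤ m) {j : Fin d → ℕ} (hj : j ∈ Jset d (m + 1)) :
    (fun i => j i / 2) ∈ Jset d m := by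
  obtain ⟨k, rfl⟩ := Nat.exists_eq_add_of_le' hm
  simp only [Jset, Fintype.mem_piFinset, mem_range, Nat.add_sub_cancel] at hj ⊢
  intro i
  have := hj i
  rw [pow_succ] at this
  omega

theorem Jset_one (d : ℕ) : Jset d 1 = {0} := by
  ext j
  simp [Jset, funext_iff]

namespace DyadicTree

variable {d H : ℕ} {X : Set (Fin d → ℝ)} {D : ℝ} (tree : DyadicTree d X D H)

theorem cell_subset {m : ℕ} (hm : 1 ≤ m) (hmH : m ≤ H) {j : Fin d → ℕ} (hj : j ∈ Jset d m) :
    tree.cell m j ⊆ X := by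
  induction m, hm using Nat.le_induction generalizing j with
  | base =>
    rw [Jset_one, mem_singleton] at hj
    rw [hj, tree.root_eq]
  | succ m hm ih =>
    exact (tree.child_sub m hm hmH j hj).trans (ih (by omega) (half_mem_Jset hm hj))

/-- The cells of each level partition the whole space. -/
theorem existsUnique_mem_cell {m : ℕ} (hm : 1 ≤ m) (hmH : m ≤ H) {y : Fin d → ℝ} (hy : y ∈ X) :
    ∃! j, j ∈ Jset d m ∧ y ∈ tree.cell m j := by
  induction m, hm using Nat.le_induction with
  | base =>
    refine ⟨0, ⟨by simp [Jset_one], by rwa [tree.root_eq]⟩, fun j hj => ?_⟩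
    simpa [Jset_one] using hj.1
  | succ m hm ih =>
    obtain ⟨j, ⟨hj, hyj⟩, huniq⟩ := ih (by omega)
    obtain ⟨j', ⟨hj', -, hyj'⟩, huniq'⟩ := tree.partition m hm hmH j hj y hyj
    refine ⟨j', ⟨hj', hyj'⟩, fun k ⟨hk, hyk⟩ => huniq' k ⟨hk, fun i => ?_, hyk⟩⟩
    exact congrFun (huniq _ ⟨half_mem_Jset hm hk, tree.child_sub m hm hmH k hk hyk⟩) i

theorem sum_mul_indR_cell {m : ℕ} (hm : 1 ≤ m) (hmH : m ≤ H) {y : Fin d → ℝ} (hy : y ∈ X)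
    {j : Fin d → ℕ} (hj : j ∈ Jset d m) (hyj : y ∈ tree.cell m j) (F : (Fin d → ℕ) → ℝ) :
    ∑ k ∈ Jset d m, F k * indR (tree.cell m k) y = F j := by
  rw [sum_eq_single_of_mem j hj, indR_of_mem hyj, mul_one]
  intro k hk hkj
  rw [indR_of_notMem, mul_zero]
  exact fun hyk => hkj ((tree.existsUnique_mem_cell hm hmH hy).unique ⟨hk, hyk⟩ ⟨hj, hyj⟩)

theorem sum_indR_cell {m : ℕ} (hm : 1 ≤ m) (hmH : m ≤ H) {y : Fin d → ℝ} (hy : y ∈ X) :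
    ∑ k ∈ Jset d m, indR (tree.cell m k) y = 1 := by
  obtain ⟨j, ⟨hj, hyj⟩, -⟩ := tree.existsUnique_mem_cell hm hmH hy
  simpa using tree.sum_mul_indR_cell hm hmH hy hj hyj fun _ => 1

end DyadicTree

/-- The increment along the edge from the parent of `(m, j)` to `(m, j)`, with the value itself at
the root. -/
def chainIncrement {d : ℕ} (F : ℕ → (Fin d → ℕ) → ℝ) (m : ℕ) (j : Fin d → ℕ) : ℝ :=
  if m ≤ 1 then F m j else F m j - F (m - 1) fun i => j i / 2

theorem chainIncrement_one {d : ℕ} (F : ℕ → (Fin d → ℕ) → ℝ) (j : Fin d → ℕ) :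
    chainIncrement F 1 j = F 1 j := by
  simp [chainIncrement]

theorem chainIncrement_succ {d m : ℕ} (hm : 1 ≤ m) (F : ℕ → (Fin d → ℕ) → ℝ) (j : Fin d → ℕ) :
    chainIncrement F (m + 1) j = F (m + 1) j - F m fun i => j i / 2 := by
  simp [chainIncrement, show m ≠ 0 by omega]

/-- Chaining: the increments telescope along the path from the root to a node. -/
theorem DyadicTree.sum_chainIncrement {d H : ℕ} {X : Set (Fin d → ℝ)} {D : ℝ}
    (tree : DyadicTree d X D H) (F : ℕ → (Fin d → ℕ) → ℝ) {m : ℕ} (hm : 1 ≤ m) (hmH : m ≤ H)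
    {y : Fin d → ℝ} (hy : y ∈ X) :
    ∑ k ∈ Icc 1 m, ∑ j ∈ Jset d k, chainIncrement F k j * indR (tree.cell k j) y =
      ∑ j ∈ Jset d m, F m j * indR (tree.cell m j) y := by
  induction m, hm using Nat.le_induction with
  | base => simp [chainIncrement_one]
  | succ m hm ih =>
    obtain ⟨j, ⟨hj, hyj⟩, -⟩ := tree.existsUnique_mem_cell (by omega) hmH hy
    rw [sum_Icc_succ_top (by omega), ih (by omega),
      tree.sum_mul_indR_cell hm (by omega) hy (half_mem_Jset hm hj)
        (tree.child_sub m hm hmH j hj hyj),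
      tree.sum_mul_indR_cell (by omega) hmH hy hj hyj,
      tree.sum_mul_indR_cell (by omega) hmH hy hj hyj, chainIncrement_succ hm]
    ring

theorem sum_sqrt_le_sqrt_card_mul_sum {ι : Type*} (s : Finset ι) {a : ι → ℝ}
    (ha : ∀ i, 0 ≤ a i) : ∑ i ∈ s, √(a i) ≤ √(s.card * ∑ i ∈ s, a i) := by
  refine Real.le_sqrt_of_sq_le (sq_sum_le_card_mul_sum_sq.trans_eq ?_)
  simp_rw [Real.sq_sqrt (ha _)]

/-- The regret of the nodes of one level, for comparators bounded by `K`. -/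
theorem DyadicTree.sum_level_le {d H : ℕ} {X : Set (Fin d → ℝ)} {D : ℝ}
    (tree : DyadicTree d X D H) {m : ℕ} (hm : 1 ≤ m) (hmH : m ≤ H) {G C₁ C₂ K : ℝ} (hG : 0 ≤ G)
    (hC₁ : 0 ≤ C₁) (hC₂ : 0 ≤ C₂) (hK : 0 ≤ K) {g : ℕ → ℝ} (hg : ∀ t, |g t| ≤ G)
    {x : ℕ → Fin d → ℝ} (hx : ∀ t, x t ∈ X) (T : ℕ) {c : (Fin d → ℕ) → ℝ}
    (hc : ∀ j ∈ Jset d m, |c j| ≤ K) :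
    ∑ j ∈ Jset d m, |c j| *
        (C₁ * √(∑ t ∈ range T, (g t * indR (tree.cell m j) (x t)) ^ 2) + C₂ * G) ≤
      K * G * (C₁ * (√(Jset d m).card * √T) + C₂ * (Jset d m).card) := by
  have hgrad (j : Fin d → ℕ) : √(∑ t ∈ range T, (g t * indR (tree.cell m j) (x t)) ^ 2) ≤
      G * √(∑ t ∈ range T, indR (tree.cell m j) (x t)) := by
    rw [← Real.sqrt_sq hG, ← Real.sqrt_mul (sq_nonneg G), mul_sum]
    refine Real.sqrt_le_sqrt (sum_le_sum fun t _ => ?_)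
    rw [mul_pow, indR_sq]
    exact mul_le_mul_of_nonneg_right (sq_le_sq' (abs_le.1 (hg t)).1 (abs_le.1 (hg t)).2)
      (indR_nonneg _ _)
  have hcount : ∑ j ∈ Jset d m, √(∑ t ∈ range T, indR (tree.cell m j) (x t)) ≤
      √(Jset d m).card * √T := by
    refine (sum_sqrt_le_sqrt_card_mul_sum _ fun j =>
      sum_nonneg fun t _ => indR_nonneg _ _).trans_eq ?_
    rw [sum_comm, sum_congr rfl fun t _ => tree.sum_indR_cell hm hmH (hx t),
      ← Real.sqrt_mul (Nat.cast_nonneg _)]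
    simp
  calc
    _ ≤ ∑ j ∈ Jset d m,
        K * (C₁ * (G * √(∑ t ∈ range T, indR (tree.cell m j) (x t))) + C₂ * G) := by
      refine sum_le_sum fun j hj => ?_
      gcongr
      · exact hc j hj
      · exact hgrad j
    _ = K * G * (C₁ * ∑ j ∈ Jset d m, √(∑ t ∈ range T, indR (tree.cell m j) (x t)) +
        C₂ * (Jset d m).card) := by
      rw [← mul_sum, sum_add_distrib, ← mul_sum, ← mul_sum, sum_const, nsmul_eq_mul]
      ring
    _ ≤ _ := by gcongr

theorem rpow_mul_sqrt_card_Jset {d m : ℕ} (hm : 1 ≤ m) (α : ℝ) :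
    (2 : ℝ) ^ (-(m * α)) * √((Jset d m).card : ℝ) =
      2 ^ (-(d : ℝ) / 2) * 2 ^ ((m : ℝ) * ((d : ℝ) / 2 - α)) := by
  rw [card_Jset, Real.sqrt_eq_rpow]
  push_cast
  rw [← pow_mul, ← Real.rpow_natCast, ← Real.rpow_mul two_pos.le, ← Real.rpow_add two_pos,
    ← Real.rpow_add two_pos]
  push_cast [hm]
  ring_nf

theorem rpow_mul_card_Jset {d m : ℕ} (hm : 1 ≤ m) (α : ℝ) :
    (2 : ℝ) ^ (-(m * α)) * ((Jset d m).card : ℝ) =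
      2 ^ (-(d : ℝ)) * 2 ^ ((m : ℝ) * ((d : ℝ) - α)) := by
  rw [card_Jset]
  push_cast
  rw [← pow_mul, ← Real.rpow_natCast, ← Real.rpow_add two_pos, ← Real.rpow_add two_pos]
  push_cast [hm]
  ring_nf

/-- Hölder continuity bounds the increments of the node values of a function. -/
theorem DyadicTree.abs_chainIncrement_le {d H : ℕ} {X : Set (Fin d → ℝ)} {D : ℝ} (hD : 0 ≤ D)
    (tree : DyadicTree d X D H)
    (hpt : ∀ m ∈ Icc 1 H, ∀ j ∈ Jset d m, tree.pt m j ∈ tree.cell m j)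
    {f : (Fin d → ℝ) → ℝ} {L α : ℝ} (hL : 0 ≤ L) (hα : 0 ≤ α)
    (hf : ∀ y ∈ X, ∀ y' ∈ X, |f y - f y'| ≤ L * ‖y - y'‖ ^ α)
    {m : ℕ} (hm : 2 ≤ m) (hmH : m ≤ H) {j : Fin d → ℕ} (hj : j ∈ Jset d m) :
    |chainIncrement (fun k i => f (tree.pt k i)) m j| ≤ L * D ^ α * 2 ^ (-(m * α)) := by
  obtain ⟨m, rfl⟩ : ∃ k, m = k + 1 := ⟨m - 1, by omega⟩
  have hm₁ : 1 ≤ m := by omega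
  have hptX {k : ℕ} (hk : 1 ≤ k) (hkH : k ≤ H) {i : Fin d → ℕ} (hi : i ∈ Jset d k) :
      tree.pt k i ∈ X :=
    tree.cell_subset hk hkH hi (hpt k (mem_Icc.2 ⟨hk, hkH⟩) i hi)
  rw [chainIncrement_succ hm₁]
  calc
    _ ≤ L * ‖tree.pt (m + 1) j - tree.pt m fun i => j i / 2‖ ^ α :=
      hf _ (hptX (by omega) hmH hj) _ (hptX hm₁ (by omega) (half_mem_Jset hm₁ hj))
    _ ≤ L * ((2 : ℝ) ^ (-((m : ℝ) + 1)) * D) ^ α := by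
      gcongr
      exact tree.parent_dist m hm₁ hmH j hj
    _ = _ := by
      rw [Real.mul_rpow (by positivity) hD, ← Real.rpow_mul two_pos.le]
      push_cast
      ring_nf

/-- Estimation-error bound of the chaining-tree algorithm against the
piecewise-constant leaf approximation of a Hölder function. -/
theorem stmt4
    (d H T : ℕ) (hd : 1 ≤ d) (hH : 1 ≤ H)
    (X : Set (Fin d → ℝ)) (hX : X.Nonempty)
    (D G B C₁ C₂ : ℝ) (hD : 0 ≤ D) (hG : 0 < G) (hB : 0 < B)
    (hC₁ : 0 < C₁) (hC₂ : 0 < C₂)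
    (tree : DyadicTree d X D H)
    (hpt : ∀ m ∈ Finset.Icc 1 H, ∀ j ∈ Jset d m, tree.pt m j ∈ tree.cell m j)
    (x : ℕ → (Fin d → ℝ)) (hx : ∀ t, x t ∈ X)
    (ℓ : ℕ → ℝ → ℝ)
    (hconv : ∀ t, ConvexOn ℝ Set.univ (ℓ t))
    (hlip : ∀ t, ∀ y y' : ℝ, |ℓ t y - ℓ t y'| ≤ G * |y - y'|)
    (θ : ℕ → (Fin d → ℕ) → ℕ → ℝ)
    (hθinit : ∀ m j, θ m j 0 = 0)
    (fhat : ℕ → (Fin d → ℝ) → ℝ)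
    (hfhat : ∀ t y, fhat t y = ∑ m ∈ Finset.Icc 1 H, ∑ j ∈ Jset d m,
      θ m j t * indR (tree.cell m j) y)
    (g : ℕ → ℝ)
    (hgbound : ∀ t, |g t| ≤ G)
    (hgsub : ∀ t, ∀ y : ℝ, ℓ t (fhat t (x t)) + g t * (y - fhat t (x t)) ≤ ℓ t y)
    (hpf : ∀ m ∈ Finset.Icc 1 H, ∀ j ∈ Jset d m, ∀ θstar : ℝ,
      ∑ t ∈ Finset.range T, (g t * indR (tree.cell m j) (x t)) * (θ m j t - θstar)
        ≤ |θstar| * (C₁ * Real.sqrt (∑ t ∈ Finset.range T,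
            (g t * indR (tree.cell m j) (x t)) ^ 2) + C₂ * G))
    (L α : ℝ) (hL : 0 < L) (hα : 0 < α) (hα1 : α ≤ 1)
    (f : (Fin d → ℝ) → ℝ)
    (hHolder : ∀ y ∈ X, ∀ y' ∈ X, |f y - f y'| ≤ L * ‖y - y'‖ ^ α)
    (hbdd : ∀ y ∈ X, |f y| ≤ B)
    (fstar : (Fin d → ℝ) → ℝ)
    (hfstar : ∀ y, fstar y = ∑ j ∈ Jset d H, f (tree.pt H j) * indR (tree.cell H j) y) :
    ∑ t ∈ Finset.range T, ℓ t (fhat t (x t)) - ∑ t ∈ Finset.range T, ℓ t (fstar (x t))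
      ≤ B * G * (C₁ * Real.sqrt T + C₂)
        + L * G * D ^ α *
          ((2 : ℝ) ^ (-(d : ℝ) / 2) * C₁ * Real.sqrt T *
              ∑ m ∈ Finset.Icc 2 H, (2 : ℝ) ^ ((m : ℝ) * ((d : ℝ) / 2 - α))
            + (2 : ℝ) ^ (-(d : ℝ)) * C₂ *
              ∑ m ∈ Finset.Icc 2 H, (2 : ℝ) ^ ((m : ℝ) * ((d : ℝ) - α))) := by
  set c := chainIncrement fun k i => f (tree.pt k i) with hc
  have hstar (t : ℕ) : fstar (x t) =
      ∑ m ∈ Icc 1 H, ∑ j ∈ Jset d m, c m j * indR (tree.cell m j) (x t) := by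
    rw [hfstar, ← tree.sum_chainIncrement (fun k i => f (tree.pt k i)) hH le_rfl (hx t)]
  have hlin : ∑ t ∈ range T, ℓ t (fhat t (x t)) - ∑ t ∈ range T, ℓ t (fstar (x t)) ≤
      ∑ m ∈ Icc 1 H, ∑ j ∈ Jset d m, ∑ t ∈ range T,
        (g t * indR (tree.cell m j) (x t)) * (θ m j t - c m j) := by
    calc
      _ ≤ ∑ t ∈ range T, g t * (fhat t (x t) - fstar (x t)) := by
        rw [← sum_sub_distrib]
        exact sum_le_sum fun t _ => by linarith [hgsub t (fstar (x t))]
      _ = ∑ t ∈ range T, ∑ m ∈ Icc 1 H, ∑ j ∈ Jset d m,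
          (g t * indR (tree.cell m j) (x t)) * (θ m j t - c m j) := by
        refine sum_congr rfl fun t _ => ?_
        simp_rw [hfhat, hstar, ← sum_sub_distrib, mul_sum]
        exact sum_congr rfl fun m _ => sum_congr rfl fun j _ => by ring
      _ = _ := by
        rw [sum_comm]
        exact sum_congr rfl fun m _ => sum_comm
  have hlevel {m : ℕ} (hm : 1 ≤ m) (hmH : m ≤ H) {K : ℝ} (hK : 0 ≤ K)
      (hcK : ∀ j ∈ Jset d m, |c m j| ≤ K) :
      ∑ j ∈ Jset d m, ∑ t ∈ range T, (g t * indR (tree.cell m j) (x t)) * (θ m j t - c m j) ≤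
        K * G * (C₁ * (√(Jset d m).card * √T) + C₂ * (Jset d m).card) :=
    (sum_le_sum fun j hj => hpf m (mem_Icc.2 ⟨hm, hmH⟩) j hj (c m j)).trans
      (tree.sum_level_le hm hmH hG.le hC₁.le hC₂.le hK hgbound hx T hcK)
  have hroot := hlevel le_rfl hH hB.le fun j hj => by
    rw [hc, chainIncrement_one]
    exact hbdd _ (tree.cell_subset le_rfl hH hj (hpt 1 (mem_Icc.2 ⟨le_rfl, hH⟩) j hj))
  refine hlin.trans ?_
  rw [← insert_Icc_add_one_left_eq_Icc hH, sum_insert (by simp)]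
  refine add_le_add (hroot.trans_eq (by simp [Jset_one])) ?_
  rw [mul_sum, mul_sum, ← sum_add_distrib, mul_sum]
  refine sum_le_sum fun m hm => ?_
  obtain ⟨hm₂, hmH⟩ := mem_Icc.1 hm
  refine (hlevel (by omega) hmH (by positivity) fun j hj =>
    tree.abs_chainIncrement_le hD hpt hL.le hα.le hHolder hm₂ hmH hj).trans_eq ?_
  linear_combination
    L * G * D ^ α * C₁ * √T * rpow_mul_sqrt_card_Jset (d := d) (show 1 ≤ m by omega) α +
    L * G * D ^ α * C₂ * rpow_mul_card_Jset (d := d) (show 1 ≤ m by omega) α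

end
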